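/- Let n ≥ 2 and let H = ℂ^{n+1} carry the 𝔰𝔲(2) quantum metric operators E, F, H₀. Suppose P is a nonzero orthogonal projection on H such that there exist scalars ε_E, ε_F, ε_H ∈ ℂ with P E P = ε_E P, P F P = ε_F P, and P H₀ P = ε_H P. Then 2 · rank P ≤ n, i.e. rank P ≤ n/2. -/

import Mathlib

noncomputable section

open Matrix

/-- The raising operator `E` of the `𝔰𝔲(2)` quantum metric on `ℂ^{n+1}`, in the
orthonormal basis `|k⟩` (`k ≡ n (mod 2)`, `−n ≤ k ≤ n`) indexed by `j : Fin (n+1)`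
via `k = 2j − n`:  `E|k⟩ = √((n−k)(n+k+2)/4)|k+2⟩` and `E|n⟩ = 0`. -/
def opE (n : ℕ) : Matrix (Fin (n + 1)) (Fin (n + 1)) ℂ :=
  Matrix.of fun a b =>
    if (a : ℕ) = (b : ℕ) + 1 then
      ((Real.sqrt (((n : ℝ) - (b : ℕ)) * ((b : ℕ) + 1)) : ℝ) : ℂ) else 0

/-- The lowering operator `F` of the `𝔰𝔲(2)` quantum metric on `ℂ^{n+1}`:
`F|k⟩ = √((n−k+2)(n+k)/4)|k−2⟩` and `F|−n⟩ = 0`. -/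
def opF (n : ℕ) : Matrix (Fin (n + 1)) (Fin (n + 1)) ℂ :=
  Matrix.of fun a b =>
    if (b : ℕ) = (a : ℕ) + 1 then
      ((Real.sqrt (((b : ℕ) : ℝ) * ((n : ℝ) + 1 - (b : ℕ))) : ℝ) : ℂ) else 0

/-- The diagonal operator `H₀` of the `𝔰𝔲(2)` quantum metric on `ℂ^{n+1}`:
`H₀|k⟩ = k|k⟩`. -/
def opH (n : ℕ) : Matrix (Fin (n + 1)) (Fin (n + 1)) ℂ :=
  Matrix.diagonal fun j => 2 * ((j : ℕ) : ℂ) - (n : ℂ)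

lemma opE_mul_opF (n : ℕ) : opE n * opF n =
    Matrix.diagonal (fun j : Fin (n+1) => ((j : ℕ) : ℂ) * ((n : ℂ) + 1 - ((j : ℕ) : ℂ))) := by
  ext a b
  rw [Matrix.mul_apply, Matrix.diagonal_apply]
  rcases Nat.eq_zero_or_pos (a : ℕ) with h0 | h0
  · rw [Finset.sum_eq_zero]
    · simp [h0]
    · intro c _
      simp [opE, h0]
  · rw [Finset.sum_eq_single (⟨(a : ℕ) - 1, by omega⟩ : Fin (n+1))]
    · have h1 : (a : ℕ) - 1 + 1 = a := by omega
      simp only [opE, opF, Matrix.of_apply, h1, if_true]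
      by_cases hab : a = b
      · subst hab
        simp only [if_true]
        have hc : (((a : ℕ) - 1 : ℕ) : ℝ) = (a : ℕ) - 1 := by
          rw [Nat.cast_sub h0]; simp
        have han : ((a : ℕ) : ℝ) ≤ n := by exact_mod_cast Nat.lt_succ_iff.mp a.2
        rw [hc, ← Complex.ofReal_mul,
          show ((n : ℝ) - ((a : ℕ) - 1)) * (((a : ℕ) : ℝ) - 1 + 1)
            = ((a : ℕ) : ℝ) * ((n : ℝ) + 1 - (a : ℕ)) by ring, Real.mul_self_sqrt]
        · push_cast; ring
        · apply mul_nonneg (by positivity); linarith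
      · have : ¬ ((b : ℕ) = a) := fun h => hab (Fin.ext h.symm)
        simp [hab, this]
    · intro c _ hc
      have : ¬ ((a : ℕ) = c + 1) := fun h => hc (Fin.ext (by simp; omega))
      simp [opE, this]
    · simp

lemma opF_mul_opE (n : ℕ) : opF n * opE n =
    Matrix.diagonal (fun j : Fin (n+1) => (((j : ℕ) : ℂ) + 1) * ((n : ℂ) - ((j : ℕ) : ℂ))) := by
  ext a b
  rw [Matrix.mul_apply, Matrix.diagonal_apply]
  rcases Nat.eq_or_lt_of_le (Nat.lt_succ_iff.mp a.2) with h0 | h0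
  · rw [Finset.sum_eq_zero]
    · simp [h0]
    · intro c _
      have : ¬ ((c : ℕ) = a + 1) := by omega
      simp [opF, this]
  · rw [Finset.sum_eq_single (⟨(a : ℕ) + 1, by omega⟩ : Fin (n+1))]
    · simp only [opE, opF, Matrix.of_apply, if_true]
      by_cases hab : a = b
      · subst hab
        simp only [if_true]
        have han : ((a : ℕ) : ℝ) ≤ n := by exact_mod_cast h0.le
        rw [← Complex.ofReal_mul,
          show ((((a : ℕ) + 1 : ℕ) : ℝ) * ((n : ℝ) + 1 - (((a : ℕ) + 1 : ℕ) : ℝ)))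
            = ((n : ℝ) - (a : ℕ)) * ((a : ℕ) + 1) by push_cast; ring, Real.mul_self_sqrt]
        · push_cast; ring
        · apply mul_nonneg _ (by positivity); linarith
      · have : ¬ ((a : ℕ) = b) := fun h => hab (Fin.ext h)
        simp [hab, this]
    · intro c _ hc
      have : ¬ ((c : ℕ) = a + 1) := fun h => hc (Fin.ext (by simp; omega))
      simp [opF, this]
    · simp

lemma opE_conj (n : ℕ) : (opE n)ᴴ = opF n := by
  ext a b
  simp only [opE, opF, Matrix.conjTranspose_apply, Matrix.of_apply]
  split_ifs with h
  · rw [h]; simp only [RCLike.star_def, Complex.conj_ofReal]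
    congr 2; push_cast; ring
  · simp

lemma opH_conj (n : ℕ) : (opH n)ᴴ = opH n := by
  unfold opH
  rw [Matrix.diagonal_conjTranspose]
  congr 1; ext j; simp

lemma comm_EF (n : ℕ) : opE n * opF n - opF n * opE n = opH n := by
  rw [opE_mul_opF, opF_mul_opE, Matrix.diagonal_sub]
  unfold opH
  congr 1; ext j; ring

lemma casimir (n : ℕ) : (2 : ℂ) • (opE n * opF n + opF n * opE n) + opH n * opH n
    = ((n : ℂ) * (n + 2)) • 1 := by
  rw [opE_mul_opF, opF_mul_opE, opH, Matrix.diagonal_mul_diagonal, Matrix.diagonal_add,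
    ← Matrix.diagonal_smul, Matrix.diagonal_add, ← Matrix.diagonal_one, ← Matrix.diagonal_smul]
  congr 1; ext j; simp; ring

lemma comm_HE (n : ℕ) : opH n * opE n - opE n * opH n = (2 : ℂ) • opE n := by
  ext a b
  simp only [opH, Matrix.sub_apply, Matrix.diagonal_mul, Matrix.mul_diagonal, Matrix.smul_apply,
    opE, Matrix.of_apply]
  split_ifs with h
  · rw [h]; push_cast; simp only [smul_eq_mul]; ring
  · simp

lemma comm_HF (n : ℕ) : opH n * opF n - opF n * opH n = -((2 : ℂ) • opF n) := by
  ext a b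
  simp only [opH, Matrix.sub_apply, Matrix.diagonal_mul, Matrix.mul_diagonal, Matrix.smul_apply,
    opF, Matrix.of_apply, Matrix.neg_apply]
  split_ifs with h
  · rw [h]; push_cast; simp only [smul_eq_mul]; ring
  · simp

lemma trace_opE (n : ℕ) : (opE n).trace = 0 := by
  simp [Matrix.trace, opE]

lemma trace_opH (n : ℕ) : (opH n).trace = 0 := by
  have h := congrArg Matrix.trace (comm_EF n)
  rw [Matrix.trace_sub, Matrix.trace_mul_comm, sub_self] at h
  exact h.symm

/-- The defect block of `X` on the complement of the code. -/
def defect {m : ℕ} (P X : Matrix (Fin m) (Fin m) ℂ) (e : ℂ) : Matrix (Fin m) (Fin m) ℂ :=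
  (1 - P) * X * (1 - P) + e • (1 - P)

lemma anti_of_defect {m : ℕ} (P X : Matrix (Fin m) (Fin m) ℂ) (e : ℂ)
    (hX : P * X * P = e • P) (hD : defect P X e = 0) :
    X * (2 * P - 1) + (2 * P - 1) * X = (2 * e) • 1 := by
  have h : X * (2 * P - 1) + (2 * P - 1) * X - (2 * e) • 1
      = (2 : ℂ) • (P * X * P - e • P) - (2 : ℂ) • defect P X e := by
    unfold defect
    simp only [mul_sub, sub_mul, mul_one, one_mul, smul_sub, smul_add, two_mul,
      mul_add, add_mul]
    module
  rw [hX, hD] at h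
  simpa [sub_eq_zero] using h

/-- Trace identity for one error operator. -/
lemma trace_identity {m : ℕ} (P X Y : Matrix (Fin m) (Fin m) ℂ) (e f : ℂ)
    (hP : P * P = P) (hX : P * X * P = e • P) (hY : P * Y * P = f • P)
    (tX : X.trace = 0) (tY : Y.trace = 0) :
    ((1 - 2 * P) * (X * Y + Y * X)).trace
      = 2 * (defect P X e * defect P Y f).trace + 2 * (e * f) * (2 * P.trace - m) := by
  have a1 : (P * X).trace = e * P.trace := by
    have := congrArg Matrix.trace hX
    rw [Matrix.trace_mul_comm, ← mul_assoc, hP] at this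
    simpa using this
  have a2 : (P * Y).trace = f * P.trace := by
    have := congrArg Matrix.trace hY
    rw [Matrix.trace_mul_comm, ← mul_assoc, hP] at this
    simpa using this
  have a3 : (P * (X * (P * Y))).trace = e * f * P.trace := by
    have : P * (X * (P * Y)) = e • (P * Y) := by
      rw [← smul_mul_assoc, ← hX]; simp only [mul_assoc]
    rw [this, Matrix.trace_smul, a2, smul_eq_mul]; ring
  have hQ : (1 - P) * (1 - P) = 1 - P := by
    simp [mul_sub, sub_mul, hP]
  have hd : (defect P X e * defect P Y f).trace
      = ((1 - P) * (X * ((1 - P) * Y))).trace + e * ((1 - P) * Y).trace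
        + f * ((1 - P) * X).trace + e * f * (1 - P).trace := by
    have : defect P X e * defect P Y f = ((1 - P) * (X * ((1 - P) * Y))) * (1 - P)
        + e • ((1 - P) * Y * (1 - P)) + f • ((1 - P) * X * (1 - P)) + (e * f) • (1 - P) := by
      unfold defect
      generalize hq : (1 - P) = Q at *
      have hq1 : ∀ Z, Q * (Q * Z) = Q * Z := fun Z => by rw [← mul_assoc, hQ]
      simp only [mul_add, add_mul, smul_mul_assoc, mul_smul_comm, mul_assoc, hq1, hQ, smul_smul,
        smul_add]
      rw [mul_comm f e]; abel
    have key : ∀ Z, ((1 - P) * Z * (1 - P)).trace = ((1 - P) * Z).trace := fun Z => by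
      rw [Matrix.trace_mul_comm, ← mul_assoc, hQ]
    rw [this]
    simp only [Matrix.trace_add, Matrix.trace_smul, key, smul_eq_mul]
  rw [hd]
  have c1 : (Y * X).trace = (X * Y).trace := Matrix.trace_mul_comm _ _
  have c2 : (P * (Y * X)).trace = (X * (P * Y)).trace := by
    rw [← mul_assoc, Matrix.trace_mul_comm]
  simp only [sub_mul, mul_sub, mul_add, one_mul, two_mul, add_mul, Matrix.trace_sub,
    Matrix.trace_add, a1, a2, a3, c1, c2, tX, tY, Matrix.trace_one, Fintype.card_fin]
  ring

lemma trace_eq_rank {m : ℕ} (P : Matrix (Fin m) (Fin m) ℂ) (hP : P * P = P) :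
    P.trace = (P.rank : ℂ) := by
  have h : IsIdempotentElem (Matrix.toLin' P) := by
    unfold IsIdempotentElem
    rw [Module.End.mul_eq_comp, ← Matrix.toLin'_mul, hP]
  have h2 := (LinearMap.IsIdempotentElem.isProj_range _ h).trace
  rw [Matrix.trace_toLin'_eq] at h2
  rw [h2]
  rfl

open scoped ComplexOrder in
/-- Distance-2 bound for the `𝔰𝔲(2)` quantum metrics: if a nonzero orthogonal
projection `P` on `ℂ^{n+1}` detects `E`, `F` and `H₀`, then `rank P ≤ n/2`. -/
theorem su2_distance_two_bound (n : ℕ) (hn : 2 ≤ n)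
    (P : Matrix (Fin (n + 1)) (Fin (n + 1)) ℂ)
    (hPherm : Pᴴ = P) (hPidem : P * P = P) (hPne : P ≠ 0)
    (εE εF εH : ℂ)
    (hE : P * opE n * P = εE • P)
    (hF : P * opF n * P = εF • P)
    (hH : P * opH n * P = εH • P) :
    2 * P.rank ≤ n := by
  have hf : εF = star εE := by
    have h := congrArg Matrix.conjTranspose hE
    rw [Matrix.conjTranspose_mul, Matrix.conjTranspose_mul, Matrix.conjTranspose_smul, hPherm,
      opE_conj, ← mul_assoc, hF] at h
    exact smul_left_injective ℂ hPne h
  have hh : εH = star εH := by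
    have h := congrArg Matrix.conjTranspose hH
    rw [Matrix.conjTranspose_mul, Matrix.conjTranspose_mul, Matrix.conjTranspose_smul, hPherm,
      opH_conj, ← mul_assoc, hH] at h
    exact smul_left_injective ℂ hPne h
  have tF : (opF n).trace = 0 := by
    rw [← opE_conj, Matrix.trace_conjTranspose, trace_opE, star_zero]
  have iE := trace_identity P _ _ _ _ hPidem hE hF (trace_opE n) tF
  have iH := trace_identity P _ _ _ _ hPidem hH hH (trace_opH n) (trace_opH n)
  have dEF : (defect P (opE n) εE)ᴴ = defect P (opF n) εF := by
    simp only [defect, Matrix.conjTranspose_add, Matrix.conjTranspose_mul,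
      Matrix.conjTranspose_smul, Matrix.conjTranspose_sub, Matrix.conjTranspose_one, hPherm,
      opE_conj, mul_assoc, hf]
  have dHH : (defect P (opH n) εH)ᴴ = defect P (opH n) εH := by
    simp only [defect, Matrix.conjTranspose_add, Matrix.conjTranspose_mul,
      Matrix.conjTranspose_smul, Matrix.conjTranspose_sub, Matrix.conjTranspose_one, hPherm,
      opH_conj, mul_assoc, ← hh]
  have nE : 0 ≤ (defect P (opE n) εE * defect P (opF n) εF).trace := by
    rw [← dEF]; exact (Matrix.posSemidef_self_mul_conjTranspose _).trace_nonneg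
  have nH : 0 ≤ (defect P (opH n) εH * defect P (opH n) εH).trace := by
    nth_rewrite 2 [← dHH]; exact (Matrix.posSemidef_self_mul_conjTranspose _).trace_nonneg
  have zE : (defect P (opE n) εE * defect P (opF n) εF).trace = 0 → defect P (opE n) εE = 0 := by
    rw [← dEF]; exact Matrix.trace_mul_conjTranspose_self_eq_zero_iff.mp
  have zH : (defect P (opH n) εH * defect P (opH n) εH).trace = 0 → defect P (opH n) εH = 0 := by
    nth_rewrite 2 [← dHH]; exact Matrix.trace_mul_conjTranspose_self_eq_zero_iff.mp
  have hsum : 2 * ((1 - 2 * P) * (opE n * opF n + opF n * opE n)).trace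
      + ((1 - 2 * P) * (opH n * opH n)).trace = (n * (n + 2)) * ((n + 1 : ℕ) - 2 * P.trace) := by
    have h := congrArg (fun M => ((1 - 2 * P) * M).trace) (casimir n)
    simp only [mul_add, mul_smul_comm, Matrix.trace_add, Matrix.trace_smul, smul_eq_mul] at h ⊢
    rw [h]
    simp [two_mul]
  rw [iE] at hsum
  have iH' : ((1 - 2 * P) * (opH n * opH n)).trace
     = (defect P (opH n) εH * defect P (opH n) εH).trace
        + (εH * εH) * (2 * P.trace - (n + 1 : ℕ)) := by
    rw [mul_add, Matrix.trace_add] at iH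
    linear_combination iH / 2
  rw [iH', trace_eq_rank P hPidem] at hsum
  by_contra hcon
  have hcon' : n + 1 ≤ 2 * P.rank := by omega
  generalize hu : (defect P (opE n) εE * defect P (opF n) εF).trace = u at *
  generalize hv : (defect P (opH n) εH * defect P (opH n) εH).trace = v at *
  have hk : (0 : ℂ) ≤ 2 * (P.rank : ℂ) - (n + 1 : ℕ) := by
    rw [sub_nonneg]; exact_mod_cast hcon'
  have he : 0 ≤ εE * εF := by rw [hf]; exact mul_star_self_nonneg _
  have hh2 : 0 ≤ εH * εH := by nth_rewrite 2 [hh]; exact mul_star_self_nonneg _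
  have hn0 : (0 : ℂ) ≤ n * (n + 2) := by positivity
  have r1 := mul_nonneg he hk
  have r2 := mul_nonneg hh2 hk
  have r3 := mul_nonneg hn0 hk
  have hz : 4 * u + v + (4 * (εE * εF * (2 * (P.rank : ℂ) - (n + 1 : ℕ)))
      + εH * εH * (2 * (P.rank : ℂ) - (n + 1 : ℕ))
      + n * (n + 2) * (2 * (P.rank : ℂ) - (n + 1 : ℕ))) = 0 := by
    linear_combination hsum
  have hrest : 0 ≤ 4 * (εE * εF * (2 * (P.rank : ℂ) - (n + 1 : ℕ)))
      + εH * εH * (2 * (P.rank : ℂ) - (n + 1 : ℕ))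
      + n * (n + 2) * (2 * (P.rank : ℂ) - (n + 1 : ℕ)) := by positivity
  have hzz := (add_eq_zero_iff_of_nonneg (by positivity) hrest).mp hz
  have hz2 := (add_eq_zero_iff_of_nonneg (by positivity) nH).mp hzz.1
  have DE := zE (by simpa using hz2.1)
  have DH := zH hz2.2
  have DF : defect P (opF n) εF = 0 := by rw [← dEF, DE, Matrix.conjTranspose_zero]
  have aE := anti_of_defect P _ _ hE DE
  have aF := anti_of_defect P _ _ hF DF
  have aH := anti_of_defect P _ _ hH DH
  have hRR : (2 * P - 1) * (2 * P - 1) = 1 := by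
    have : (2 * P - 1) * (2 * P - 1) = 4 * (P * P) - 4 * P + 1 := by noncomm_ring
    rw [this, hPidem]; simp
  generalize 2 * P - 1 = R at *
  have hc : ∀ (X Y : Matrix (Fin (n + 1)) (Fin (n + 1)) ℂ) (x y : ℂ),
      X * R + R * X = (2 * x) • 1 → Y * R + R * Y = (2 * y) • 1 →
      (X * Y - Y * X) * R - R * (X * Y - Y * X) = (4 * y) • X - (4 * x) • Y := by
    intro X Y x y h1 h2
    have e1 : (X * Y - Y * X) * R - R * (X * Y - Y * X)
      = X * (Y * R + R * Y) - (X * R + R * X) * Y - Y * (X * R + R * X) + (Y * R + R * Y) * X := by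
      noncomm_ring
    rw [e1, h1, h2]
    simp only [mul_smul_comm, smul_mul_assoc, mul_one, one_mul]
    module
  have bH := hc _ _ _ _ aE aF
  have bE := hc _ _ _ _ aH aE
  have bF := hc _ _ _ _ aH aF
  rw [comm_EF] at bH
  rw [comm_HE] at bE
  rw [comm_HF] at bF
  have n1 : (1 : ℂ) - n ≠ 0 := by
    intro h
    have : (n : ℂ) = 1 := by linear_combination -h
    have : n = 1 := by exact_mod_cast this
    omega
  have gE : opE n * R = εE • 1 + εE • opH n - εH • opE n := by
    have : (4 : ℂ) • (opE n * R) = (4 : ℂ) • (εE • 1 + εE • opH n - εH • opE n) := by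
      calc (4 : ℂ) • (opE n * R) = (2 : ℂ) • (opE n * R + R * opE n)
            + (((2 : ℂ) • opE n) * R - R * ((2 : ℂ) • opE n)) := by
              simp only [mul_smul_comm, smul_mul_assoc]; module
        _ = _ := by rw [aE, bE]; module
    exact smul_right_injective _ (by norm_num : (4 : ℂ) ≠ 0) this
  have gF : opF n * R = εF • 1 - εF • opH n + εH • opF n := by
    have : (4 : ℂ) • (opF n * R) = (4 : ℂ) • (εF • 1 - εF • opH n + εH • opF n) := by
      calc (4 : ℂ) • (opF n * R) = (2 : ℂ) • (opF n * R + R * opF n)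
            - ((-((2 : ℂ) • opF n)) * R - R * (-((2 : ℂ) • opF n))) := by
              simp only [mul_smul_comm, smul_mul_assoc, mul_neg, neg_mul]; module
        _ = _ := by rw [aF, bF]; module
    exact smul_right_injective _ (by norm_num : (4 : ℂ) ≠ 0) this
  have e0 : εE = 0 := by
    have h := congrFun (congrFun gE 0) 0
    have h0 : (opE n * R) 0 0 = 0 := by
      rw [Matrix.mul_apply]; apply Finset.sum_eq_zero; intro c _; simp [opE]
    rw [h0] at h
    simp [opE, opH] at h
    have : εE * (1 - n) = 0 := by linear_combination -h
    exact (mul_eq_zero.mp this).resolve_right n1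
  have f0 : εF = 0 := by rw [hf, e0, star_zero]
  rw [e0, f0] at bH
  have gH : opH n * R = εH • 1 := by
    have : (2 : ℂ) • (opH n * R) = (2 : ℂ) • (εH • 1 : Matrix (Fin (n + 1)) (Fin (n + 1)) ℂ) := by
      calc (2 : ℂ) • (opH n * R) = (opH n * R + R * opH n) + (opH n * R - R * opH n) := by module
        _ = _ := by rw [aH, bH]; module
    exact smul_right_injective _ (by norm_num : (2 : ℂ) ≠ 0) this
  have gR : opH n = εH • R := by
    calc opH n = (opH n * R) * R := by rw [mul_assoc, hRR, mul_one]
      _ = _ := by rw [gH]; simp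
  have gS : opH n * opH n = (εH * εH) • 1 := by
    rw [gR]; simp only [mul_smul_comm, smul_mul_assoc, hRR, smul_smul]
  rw [opH, Matrix.diagonal_mul_diagonal] at gS
  have s0 := congrFun (congrFun gS ⟨0, by omega⟩) ⟨0, by omega⟩
  have s1 := congrFun (congrFun gS ⟨1, by omega⟩) ⟨1, by omega⟩
  simp only [Matrix.diagonal_apply_eq, Matrix.smul_apply, Matrix.one_apply_eq, smul_eq_mul,
    mul_one] at s0 s1
  push_cast at s0 s1
  apply n1
  linear_combination (s1 - s0) / 4

end
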